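/- Let 𝓛 = (L_0, L_1, …, L_r) be a tuple of Z_K-lattices in V. Then 𝓛 has class number one (i.e. every tuple in the genus of 𝓛 is isometric to 𝓛) if and only if the lattice L_0 has class number one and the finite group Aut(L_0) = {g ∈ O(V,Φ) : L_0 g = L_0} acts transitively on the set of tuples 𝓛' = (L'_0, …, L'_r) in the genus of 𝓛 with L'_0 = L_0. -/

import Mathlib

/-
STATEMENT 12: Let 𝓛 = (L_0, L_1, …, L_r) be a tuple of Z_K-lattices in V.
Then 𝓛 has class number one (every tuple in the genus of 𝓛 is isometric to 𝓛)
if and only if the lattice L_0 has class number one and the finite group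
Aut(L_0) = {g ∈ O(V,Φ) : L_0 g = L_0} acts transitively on the set of tuples
𝓛' = (L'_0, …, L'_r) in the genus of 𝓛 with L'_0 = L_0.
-/

set_option maxHeartbeats 1000000
set_option synthInstance.maxHeartbeats 1000000

open NumberField IsDedekindDomain TensorProduct
open scoped nonZeroDivisors

noncomputable instance adicSMulCommClass {K : Type*} [Field K] [NumberField K]
    (v : HeightOneSpectrum (𝓞 K)) :
    SMulCommClass K (v.adicCompletion K) (v.adicCompletion K) :=
  Algebra.to_smulCommClass

variable {K : Type*} [Field K] [NumberField K]
variable {V : Type*} [AddCommGroup V] [Module K V]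
  [Module (𝓞 K) V] [IsScalarTower (𝓞 K) K V]

/-- The `Z_{K_p}`-submodule of `V_p = K_p ⊗ V` generated by (the image of) a
`Z_K`-submodule `N` of `V`. -/
noncomputable def latCompletion (v : HeightOneSpectrum (𝓞 K)) (N : Submodule (𝓞 K) V) :
    Submodule ((v.adicCompletionIntegers K).toSubring) ((v.adicCompletion K) ⊗[K] V) :=
  Submodule.span _ ((fun x : V => (1 : v.adicCompletion K) ⊗ₜ[K] x) '' (N : Set V))

/-- `N` is a `Z_K`-lattice in `V`: a finitely generated `Z_K`-submodule
containing a `K`-basis of `V`. -/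
def IsZLat (N : Submodule (𝓞 K) V) : Prop :=
  N.FG ∧ Submodule.span K (N : Set V) = ⊤

/-- Two tuples of `Z_K`-lattices are in the same genus: for every maximal ideal
(height-one prime) `v` of `Z_K` there is an isometry of the completed space
`(V_v, Φ_v)` carrying the completions of the members of one tuple to those of
the other. -/
def SameGenus (Φ : LinearMap.BilinForm K V) {ι : Type*}
    (L L' : ι → Submodule (𝓞 K) V) : Prop :=
  ∀ v : HeightOneSpectrum (𝓞 K),
    ∃ g : ((v.adicCompletion K) ⊗[K] V) ≃ₗ[v.adicCompletion K]
        ((v.adicCompletion K) ⊗[K] V),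
      (∀ x y, Φ.baseChange (v.adicCompletion K) (g x) (g y) =
        Φ.baseChange (v.adicCompletion K) x y) ∧
      ∀ i, ⇑g '' ((latCompletion v (L i) : Set _)) = (latCompletion v (L' i) : Set _)

/-- Two tuples of `Z_K`-lattices are isometric: some isometry of `(V, Φ)` maps
each member of the first tuple onto the corresponding member of the second. -/
def IsIsom (Φ : LinearMap.BilinForm K V) {ι : Type*}
    (L L' : ι → Submodule (𝓞 K) V) : Prop :=
  ∃ g : V ≃ₗ[K] V, (∀ x y, Φ (g x) (g y) = Φ x y) ∧
    ∀ i, ⇑g '' ((L i : Set V)) = ((L' i : Set V))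

/-- The genus of a tuple of lattices, as a set of tuples of lattices. -/
def genusSet (Φ : LinearMap.BilinForm K V) {ι : Type*}
    (L : ι → Submodule (𝓞 K) V) : Set (ι → Submodule (𝓞 K) V) :=
  {L' | (∀ i, IsZLat (L' i)) ∧ SameGenus Φ L L'}

/-- The class number of a tuple of lattices: the number of isometry classes in
its genus. -/
noncomputable def classNumber (Φ : LinearMap.BilinForm K V) {ι : Type*}
    (L : ι → Submodule (𝓞 K) V) : ℕ :=
  Nat.card (Quot (fun X Y : genusSet Φ L => IsIsom Φ X.1 Y.1))


section Helpers

set_option linter.unusedSectionVars false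
open IsDedekindDomain.HeightOneSpectrum

lemma sa_aux (w : HeightOneSpectrum (𝓞 K)) (d : 𝓞 K) (hd : d ≠ 0) :
    ∃ e : 𝓞 K, w.intValuation (1 - e) ≤ w.intValuation d ∧
      ∀ w' : HeightOneSpectrum (𝓞 K), w' ≠ w → w'.intValuation e ≤ w'.intValuation d := by
  have hI : Ideal.span {d} ≠ (⊥ : Ideal (𝓞 K)) := by simpa using hd
  have hfin : FiniteMultiplicity w.asIdeal (Ideal.span {d}) :=
    FiniteMultiplicity.of_prime_left w.prime hI
  obtain ⟨J, hJ, hnd⟩ := hfin.exists_eq_pow_mul_and_not_dvd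
  set k := multiplicity w.asIdeal (Ideal.span {d}) with hk
  have hmax : w.asIdeal.IsMaximal := w.isMaximal
  have hcop : IsCoprime (w.asIdeal ^ k) J := by
    apply IsCoprime.pow_left
    rw [Ideal.isCoprime_iff_sup_eq]
    by_contra hne
    apply hnd
    rw [Ideal.dvd_iff_le]
    have := hmax.eq_of_le hne le_sup_left
    rw [this]; exact le_sup_right
  obtain ⟨i, hi, e, he, hie⟩ := Ideal.isCoprime_iff_exists.1 hcop
  refine ⟨e, ?_, ?_⟩
  · rw [show 1 - e = i by rw [← hie]; ring, w.intValuation_eq_exp_neg_multiplicity hd]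
    exact (w.intValuation_le_pow_iff_mem i k).2 hi
  · intro w' hw'
    rw [w'.intValuation_eq_exp_neg_multiplicity hd]
    rw [intValuation_le_pow_iff_dvd]
    have h1 : w'.asIdeal ^ (multiplicity w'.asIdeal (Ideal.span {d})) ∣ w.asIdeal ^ k * J := by
      rw [← hJ]; exact pow_multiplicity_dvd _ _
    have hc : IsCoprime (w'.asIdeal ^ (multiplicity w'.asIdeal (Ideal.span {d})))
        (w.asIdeal ^ k) := by
      apply IsCoprime.pow
      rw [Ideal.isCoprime_iff_sup_eq]
      apply Ideal.IsMaximal.coprime_of_ne w'.isMaximal w.isMaximal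
      intro h
      exact hw' (HeightOneSpectrum.ext h)
    exact (hc.dvd_of_dvd_mul_left h1).trans (Ideal.dvd_span_singleton.2 he)

lemma sa (w : HeightOneSpectrum (𝓞 K)) (d : 𝓞 K) (hd : d ≠ 0) (o : w.adicCompletion K)
    (ho : Valued.v o ≤ 1) :
    ∃ a : 𝓞 K, Valued.v (o - algebraMap K _ (algebraMap _ K a)) ≤ w.intValuation d ∧
      ∀ w' : HeightOneSpectrum (𝓞 K), w' ≠ w → w'.intValuation a ≤ w'.intValuation d := by
  have hd0 : w.intValuation d ≠ 0 := w.intValuation_ne_zero d hd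
  obtain ⟨e, he, he'⟩ := sa_aux w d hd
  have hval : ∀ x : K, Valued.v (algebraMap K (w.adicCompletion K) x) = w.valuation K x :=
    fun x => valuedAdicCompletion_eq_valuation' w x
  obtain ⟨q, hq⟩ : ∃ q : K, Valued.v (o - algebraMap K _ q) < w.intValuation d := by
    have hopen : IsOpen {y : w.adicCompletion K | Valued.v (o - y) < w.intValuation d} := by
      have h1 : IsOpen {y : w.adicCompletion K | Valued.v y < w.intValuation d} := by
        have h2 := Valued.isOpen_ball (w.adicCompletion K)
          (Valued.v.restrict (algebraMap K (w.adicCompletion K) (algebraMap (𝓞 K) K d)))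
        simpa only [Valuation.restrict_lt_iff, hval, valuation_of_algebraMap] using h2
      exact h1.preimage (continuous_const.sub continuous_id)
    obtain ⟨q, hq⟩ := (denseRange_algebraMap K w).exists_mem_open hopen
      ⟨o, by simpa [zero_lt_iff] using hd0⟩
    exact ⟨q, hq⟩
  have hq1 : w.valuation K q ≤ 1 := by
    rw [← hval, show algebraMap K (w.adicCompletion K) q = o - (o - algebraMap K _ q) by ring]
    refine (Valuation.map_sub _ _ _).trans (max_le ho (hq.le.trans (w.intValuation_le_one d)))
  obtain ⟨a, ha⟩ := exists_valuation_sub_lt_of_integer w hq1 (γ := Units.mk0 _ hd0)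
  refine ⟨a * e, ?_, ?_⟩
  · have h : o - algebraMap K (w.adicCompletion K) (algebraMap _ K (a * e)) =
        (o - algebraMap K _ q) + (algebraMap K _ (q - algebraMap _ K a)
          + algebraMap K _ (algebraMap _ K (a * (1 - e)))) := by
      simp only [map_sub, map_mul, map_one]; ring
    rw [h]
    refine (Valuation.map_add _ _ _).trans (max_le hq.le
      ((Valuation.map_add _ _ _).trans (max_le ?_ ?_)))
    · rw [hval, Valuation.map_sub_swap]; exact ha.le
    · rw [hval, valuation_of_algebraMap, map_mul]
      exact (mul_le_of_le_one_left' (w.intValuation_le_one a)).trans he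
  · intro w' hw'
    rw [map_mul]
    exact (mul_le_of_le_one_left' (w'.intValuation_le_one a)).trans (he' w' hw')

/-- The embedding of the ring of integers into a completion. -/
noncomputable def emb (w : HeightOneSpectrum (𝓞 K)) : 𝓞 K →+* w.adicCompletion K :=
  (algebraMap K (w.adicCompletion K)).comp (algebraMap (𝓞 K) K)

lemma emb_val (w : HeightOneSpectrum (𝓞 K)) (c : 𝓞 K) :
    Valued.v (emb w c) = w.intValuation c := by
  rw [← valuation_of_algebraMap (K := K)]
  exact valuedAdicCompletion_eq_valuation' w (algebraMap (𝓞 K) K c)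

lemma emb_ne_zero (w : HeightOneSpectrum (𝓞 K)) {c : 𝓞 K} (hc : c ≠ 0) : emb w c ≠ 0 := by
  intro h
  have := emb_val w c
  rw [h, map_zero] at this
  exact w.intValuation_ne_zero c hc this.symm

lemma emb_div (w : HeightOneSpectrum (𝓞 K)) {d : 𝓞 K} (hd : d ≠ 0) (k : w.adicCompletion K)
    (hk : Valued.v k ≤ w.intValuation d) :
    ∃ u : w.adicCompletion K, Valued.v u ≤ 1 ∧ k = emb w d * u := by
  refine ⟨k / emb w d, ?_, ?_⟩
  · rw [map_div₀, emb_val]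
    exact div_le_one_of_le₀ hk zero_le
  · rw [mul_div_cancel₀ _ (emb_ne_zero w hd)]

lemma one_tmul_smul (w : HeightOneSpectrum (𝓞 K)) (c : 𝓞 K) (x : V) :
    (1 : w.adicCompletion K) ⊗ₜ[K] (c • x) = emb w c • ((1 : w.adicCompletion K) ⊗ₜ[K] x) := by
  rw [← algebraMap_smul K c x, ← TensorProduct.smul_tmul, TensorProduct.smul_tmul', 
    Algebra.smul_def]
  rfl

lemma smul_mem' (w : HeightOneSpectrum (𝓞 K)) 
    (P : Submodule ((w.adicCompletionIntegers K).toSubring) ((w.adicCompletion K) ⊗[K] V))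
    {k : w.adicCompletion K} (hk : Valued.v k ≤ 1) {x : (w.adicCompletion K) ⊗[K] V}
    (hx : x ∈ P) : k • x ∈ P :=
  P.smul_mem (⟨k, hk⟩ : (w.adicCompletionIntegers K).toSubring) hx

lemma emb_smul_mem (w : HeightOneSpectrum (𝓞 K)) 
    (P : Submodule ((w.adicCompletionIntegers K).toSubring) ((w.adicCompletion K) ⊗[K] V))
    (c : 𝓞 K) {x : (w.adicCompletion K) ⊗[K] V}
    (hx : x ∈ P) : emb w c • x ∈ P :=
  smul_mem' w P (by rw [emb_val]; exact w.intValuation_le_one c) hx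

lemma one_tmul_mem (w : HeightOneSpectrum (𝓞 K)) {N : Submodule (𝓞 K) V} {x : V} (hx : x ∈ N) :
    (1 : w.adicCompletion K) ⊗ₜ[K] x ∈ latCompletion w N :=
  Submodule.subset_span ⟨x, hx, rfl⟩

lemma latCompletion_le (w : HeightOneSpectrum (𝓞 K)) {N : Submodule (𝓞 K) V}
    {P : Submodule ((w.adicCompletionIntegers K).toSubring) ((w.adicCompletion K) ⊗[K] V)}
    (h : ∀ x ∈ N, (1 : w.adicCompletion K) ⊗ₜ[K] x ∈ P) : latCompletion w N ≤ P := by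
  refine Submodule.span_le.2 ?_
  rintro _ ⟨x, hx, rfl⟩
  exact h x hx

lemma approx (w : HeightOneSpectrum (𝓞 K)) (N : Submodule (𝓞 K) V) (d : 𝓞 K) (hd : d ≠ 0)
    (t : (w.adicCompletion K) ⊗[K] V) (ht : t ∈ latCompletion w N) :
    ∃ y ∈ N, (∃ m ∈ latCompletion w N, t - (1 : w.adicCompletion K) ⊗ₜ[K] y = emb w d • m) ∧
      ∀ w' : HeightOneSpectrum (𝓞 K), w' ≠ w →
        ∃ m ∈ latCompletion w' N, (1 : w'.adicCompletion K) ⊗ₜ[K] y = emb w' d • m := by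
  have step : ∀ (o : w.adicCompletion K), Valued.v o ≤ 1 → ∀ y ∈ N, ∃ a : 𝓞 K,
      (∃ m ∈ latCompletion w N, o • ((1 : w.adicCompletion K) ⊗ₜ[K] y) 
        - (1 : w.adicCompletion K) ⊗ₜ[K] (a • y) = emb w d • m) ∧
      ∀ w' : HeightOneSpectrum (𝓞 K), w' ≠ w →
        ∃ m ∈ latCompletion w' N, (1 : w'.adicCompletion K) ⊗ₜ[K] (a • y) = emb w' d • m := by
    intro o ho y hy
    obtain ⟨a, ha, ha'⟩ := sa w d hd o ho
    refine ⟨a, ?_, ?_⟩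
    · obtain ⟨u, hu, hu'⟩ := emb_div w hd _ ha
      refine ⟨u • (1 ⊗ₜ y), smul_mem' w _ hu (one_tmul_mem w hy), ?_⟩
      rw [one_tmul_smul, smul_smul, ← hu']
      exact (sub_smul o (emb w a) ((1 : w.adicCompletion K) ⊗ₜ[K] y)).symm
    · intro w' hw'
      have := ha' w' hw'
      rw [← emb_val] at this
      obtain ⟨u, hu, hu'⟩ := emb_div w' hd _ this
      refine ⟨u • (1 ⊗ₜ y), smul_mem' w' _ hu (one_tmul_mem w' hy), ?_⟩
      rw [one_tmul_smul, smul_smul, ← hu']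
  induction ht using Submodule.span_induction with
  | mem x hx =>
    obtain ⟨y, hy, rfl⟩ := hx
    obtain ⟨a, h1, h2⟩ := step 1 (by simp) y hy
    rw [one_smul] at h1
    exact ⟨a • y, N.smul_mem a hy, h1, h2⟩
  | zero =>
    exact ⟨0, N.zero_mem, ⟨0, Submodule.zero_mem _, by simp⟩, 
      fun w' _ => ⟨0, Submodule.zero_mem _, by simp⟩⟩
  | add s t _ _ ihs iht =>
    obtain ⟨y, hy, ⟨m, hm, hm'⟩, h⟩ := ihs
    obtain ⟨y', hy', ⟨n, hn, hn'⟩, h'⟩ := iht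
    refine ⟨y + y', N.add_mem hy hy', ⟨m + n, Submodule.add_mem _ hm hn, ?_⟩, ?_⟩
    · rw [smul_add, ← hm', ← hn', TensorProduct.tmul_add]; abel
    · intro w' hw'
      obtain ⟨m, hm, hm'⟩ := h w' hw'
      obtain ⟨n, hn, hn'⟩ := h' w' hw'
      exact ⟨m + n, Submodule.add_mem _ hm hn, by rw [smul_add, ← hm', ← hn', TensorProduct.tmul_add]⟩
  | smul o t _ iht =>
    obtain ⟨y, hy, ⟨m, hm, hm'⟩, h⟩ := iht
    obtain ⟨a, ⟨n, hn, hn'⟩, h2⟩ := step o.1 o.2 y hy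
    refine ⟨a • y, N.smul_mem a hy, ⟨o • m + n, Submodule.add_mem _ 
      (Submodule.smul_mem _ _ hm) hn, ?_⟩, h2⟩
    rw [smul_add, ← hn']
    have e1 : emb w d • o • m = o.1 • emb w d • m := smul_comm (emb w d) o.1 m
    have e2 : o • t = o.1 • t := rfl
    rw [e1, ← hm', e2, smul_sub]; abel

lemma fg_of_forall (N : Submodule (𝓞 K) V) [FiniteDimensional K V] (hN : N.FG)
    (N' : Submodule (𝓞 K) V) (c : 𝓞 K) (hc : c ≠ 0)
    (h : ∀ x ∈ N', ∀ w : HeightOneSpectrum (𝓞 K),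
      emb w c • ((1 : w.adicCompletion K) ⊗ₜ[K] x) ∈ latCompletion w N) : N'.FG := by
  classical
  let b := Module.finBasis K V
  obtain ⟨a, ha, hab⟩ : ∃ a : 𝓞 K, a ≠ 0 ∧ ∀ x ∈ N, ∀ j, ∃ z : 𝓞 K,
      algebraMap _ K z = algebraMap _ K a * b.repr x j := by
    obtain ⟨s, rfl⟩ := hN
    obtain ⟨a, ha⟩ := IsLocalization.exist_integer_multiples_of_finset ((𝓞 K)⁰)
      ((s ×ˢ Finset.univ).image (fun p : V × Fin (Module.finrank K V) => b.repr p.1 p.2))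
    refine ⟨a, nonZeroDivisors.ne_zero a.2, ?_⟩
    intro x hx j
    induction hx using Submodule.span_induction with
    | mem x hx =>
      obtain ⟨z, hz⟩ := ha (b.repr x j) (by
        simp only [Finset.mem_image, Finset.mem_product, Finset.mem_univ, and_true, Prod.exists]
        exact ⟨x, j, hx, rfl⟩)
      exact ⟨z, by rw [hz, Algebra.smul_def]⟩
    | zero => exact ⟨0, by simp⟩
    | add x y _ _ hx hy =>
      obtain ⟨z, hz⟩ := hx
      obtain ⟨z', hz'⟩ := hy
      exact ⟨z + z', by simp [hz, hz', mul_add]⟩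
    | smul r x _ hx =>
      obtain ⟨z, hz⟩ := hx
      refine ⟨r * z, ?_⟩
      rw [← algebraMap_smul K r x]
      simp only [map_mul, hz, map_smul, Finsupp.smul_apply, smul_eq_mul]
      ring
  have hloc : ∀ w : HeightOneSpectrum (𝓞 K), ∀ z ∈ latCompletion w N, ∀ j,
      Valued.v (emb w a * (b.baseChange (w.adicCompletion K)).repr z j) ≤ 1 := by
    intro w z hz j
    induction hz using Submodule.span_induction with
    | mem x hx =>
      obtain ⟨y, hy, rfl⟩ := hx
      obtain ⟨z, hz⟩ := hab y hy j
      have e : emb w a * (b.baseChange (w.adicCompletion K)).repr (1 ⊗ₜ y) j = emb w z := by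
        rw [Module.Basis.baseChange_repr_tmul]
        simp only [emb, RingHom.comp_apply, hz, map_mul, Algebra.smul_def, mul_one]
      rw [e, emb_val]
      exact w.intValuation_le_one z
    | zero => simp
    | add x y _ _ hx hy =>
      rw [map_add, Finsupp.add_apply, mul_add]
      exact (Valuation.map_add _ _ _).trans (max_le hx hy)
    | smul r x _ hx =>
      have e : r • x = r.1 • x := rfl
      rw [e, map_smul, Finsupp.smul_apply, smul_eq_mul, mul_left_comm, map_mul]
      exact mul_le_one' r.2 hx
  have hca : c * a ≠ 0 := mul_ne_zero hc ha
  have hinj : Function.Injective (LinearMap.lsmul (𝓞 K) V (c * a)) := by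
    intro x y hxy
    simp only [LinearMap.lsmul_apply] at hxy
    rw [← algebraMap_smul K (c * a) x, ← algebraMap_smul K (c * a) y] at hxy
    exact smul_right_injective V (by simpa using hca) hxy
  apply Submodule.fg_of_fg_map_injective (LinearMap.lsmul (𝓞 K) V (c * a)) hinj
  have hle : N'.map (LinearMap.lsmul (𝓞 K) V (c * a)) ≤ Submodule.span (𝓞 K) (Set.range b) := by
    rintro _ ⟨x, hx, rfl⟩
    have hint : ∀ j, ∃ z : 𝓞 K, algebraMap _ K z = b.repr ((c * a) • x) j := by
      intro j
      apply mem_integers_of_valuation_le_one (R := 𝓞 K) K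
      intro w
      have h1 := hloc w _ (h x hx w) j
      have e : emb w a * (b.baseChange (w.adicCompletion K)).repr
          (emb w c • (1 ⊗ₜ x)) j = algebraMap K _ (b.repr ((c * a) • x) j) := by
        rw [← algebraMap_smul K (c * a) x, map_smul, map_smul, Finsupp.smul_apply,
          Finsupp.smul_apply, Module.Basis.baseChange_repr_tmul]
        simp only [emb, RingHom.comp_apply, map_mul, Algebra.smul_def, mul_one]
        simp only [Algebra.algebraMap_self, RingHom.id_apply]
        ring
      rw [e] at h1
      rw [← valuedAdicCompletion_eq_valuation']
      exact h1
    choose z hz using hint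
    change (c * a) • x ∈ _
    rw [← b.sum_repr ((c * a) • x)]
    refine Submodule.sum_mem _ fun j _ => ?_
    rw [← hz j, algebraMap_smul]
    exact Submodule.smul_mem _ _ (Submodule.subset_span ⟨j, rfl⟩)
  have hn : IsNoetherian (𝓞 K) (Submodule.span (𝓞 K) (Set.range b)) :=
    isNoetherian_span_of_finite _ (Set.finite_range b)
  exact (isNoetherian_submodule.1 hn) _ hle

lemma latCompletion_smul (w : HeightOneSpectrum (𝓞 K)) {N : Submodule (𝓞 K) V}
    {P : Submodule ((w.adicCompletionIntegers K).toSubring) ((w.adicCompletion K) ⊗[K] V)}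
    (g : ((w.adicCompletion K) ⊗[K] V) →ₗ[w.adicCompletion K] ((w.adicCompletion K) ⊗[K] V))
    (k : w.adicCompletion K)
    (h : ∀ x ∈ N, k • g ((1 : w.adicCompletion K) ⊗ₜ[K] x) ∈ P) :
    ∀ m ∈ latCompletion w N, k • g m ∈ P := by
  intro m hm
  induction hm using Submodule.span_induction with
  | mem x hx =>
    obtain ⟨y, hy, rfl⟩ := hx
    exact h y hy
  | zero => simp
  | add x y _ _ hx hy =>
    rw [map_add, smul_add]; exact P.add_mem hx hy
  | smul r x _ hx =>
    have e : r • x = r.1 • x := rfl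
    rw [e, map_smul, smul_comm]
    exact P.smul_mem r hx

lemma glue [FiniteDimensional K V] (N : Submodule (𝓞 K) V) (hN : IsZLat N) (c : 𝓞 K) (hc : c ≠ 0)
    (T : ∀ w : HeightOneSpectrum (𝓞 K), 
      Submodule ((w.adicCompletionIntegers K).toSubring) ((w.adicCompletion K) ⊗[K] V))
    (h1 : ∀ w, ∀ x ∈ latCompletion w N, emb w c • x ∈ T w)
    (h2 : ∀ w, ∀ x ∈ T w, emb w c • x ∈ latCompletion w N) :
    ∃ N' : Submodule (𝓞 K) V, IsZLat N' ∧ ∀ w, latCompletion w N' = T w := by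
  let N' : Submodule (𝓞 K) V :=
    { carrier := {x | ∀ w : HeightOneSpectrum (𝓞 K), (1 : w.adicCompletion K) ⊗ₜ[K] x ∈ T w}
      add_mem' := by
        intro x y hx hy w
        rw [TensorProduct.tmul_add]
        exact (T w).add_mem (hx w) (hy w)
      zero_mem' := by
        intro w
        rw [TensorProduct.tmul_zero]
        exact (T w).zero_mem
      smul_mem' := by
        intro a x hx w
        rw [one_tmul_smul]
        exact emb_smul_mem w _ a (hx w) }
  have hmem : ∀ x, x ∈ N' ↔ ∀ w : HeightOneSpectrum (𝓞 K), 
    (1 : w.adicCompletion K) ⊗ₜ[K] x ∈ T w := fun x => Iff.rfl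
  have hcN : ∀ x ∈ N, c • x ∈ N' := by
    intro x hx w
    rw [one_tmul_smul]
    exact h1 w _ (one_tmul_mem w hx)
  have hcK : algebraMap (𝓞 K) K c ≠ 0 := by simpa using hc
  refine ⟨N', ⟨?_, ?_⟩, ?_⟩
  · exact fg_of_forall N hN.1 N' c hc fun x hx w => h2 w _ (hx w)
  · rw [eq_top_iff, ← hN.2, Submodule.span_le]
    intro x hx
    have : x = (algebraMap (𝓞 K) K c)⁻¹ • (c • x) := by
      rw [← algebraMap_smul K c x, inv_smul_smul₀ hcK]
    rw [this]
    exact Submodule.smul_mem _ _ (Submodule.subset_span (hcN x hx))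
  · intro w
    refine le_antisymm (latCompletion_le w fun x hx => hx w) ?_
    intro t ht
    obtain ⟨y, hy, ⟨m, hm, hm'⟩, h⟩ := approx w N (c * c) (mul_ne_zero hc hc) _ (h2 w t ht)
    obtain ⟨x, rfl⟩ : ∃ x : V, y = c • x := ⟨(algebraMap (𝓞 K) K c)⁻¹ • y, by
      rw [← algebraMap_smul K c, smul_inv_smul₀ hcK]⟩
    have e1 : t - (1 : w.adicCompletion K) ⊗ₜ[K] x = emb w c • m := by
      apply smul_right_injective _ (emb_ne_zero w hc)
      simp only
      rw [smul_smul, ← map_mul, ← hm', one_tmul_smul, smul_sub]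
    have hcm : emb w c • m ∈ latCompletion w N' :=
      latCompletion_smul w LinearMap.id (emb w c) (fun x hx => by
        rw [LinearMap.id_apply, ← one_tmul_smul]
        exact one_tmul_mem w (hcN x hx)) m hm
    have hx : x ∈ N' := by
      intro w'
      by_cases hw : w' = w
      · subst hw
        have : (1 : w'.adicCompletion K) ⊗ₜ[K] x = t - emb w' c • m := by
          rw [← e1]; abel
        rw [this]
        exact (T w').sub_mem ht (h1 w' m hm)
      · obtain ⟨n, hn, hn'⟩ := h w' hw
        have : (1 : w'.adicCompletion K) ⊗ₜ[K] x = emb w' c • n := by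
          apply smul_right_injective _ (emb_ne_zero w' hc)
          simp only
          rw [smul_smul, ← map_mul, ← hn', one_tmul_smul]
        rw [this]
        exact h1 w' n hn
    have : t = (1 : w.adicCompletion K) ⊗ₜ[K] x + emb w c • m := by rw [← e1]; abel
    rw [this]
    exact Submodule.add_mem _ (one_tmul_mem w hx) hcm

lemma fin_prod {X : Type*} (s : Finset X) (P : X → 𝓞 K → Prop)
    (hmono : ∀ x a b, P x a → P x (b * a)) (h : ∀ x ∈ s, ∃ a, a ≠ 0 ∧ P x a) :
    ∃ a, a ≠ 0 ∧ ∀ x ∈ s, P x a := by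
  classical
  induction s using Finset.induction_on with
  | empty => exact ⟨1, one_ne_zero, by simp⟩
  | insert x s _ ih =>
    obtain ⟨a, ha, ha'⟩ := ih fun y hy => h y (Finset.mem_insert_of_mem hy)
    obtain ⟨b, hb, hb'⟩ := h x (Finset.mem_insert_self x s)
    refine ⟨a * b, mul_ne_zero ha hb, ?_⟩
    intro y hy
    rcases Finset.mem_insert.1 hy with rfl | hy
    · exact hmono _ _ _ hb'
    · rw [mul_comm]; exact hmono _ _ _ (ha' y hy)

lemma bound0 {N : Submodule (𝓞 K) V} (hN : IsZLat N) (w : HeightOneSpectrum (𝓞 K))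
    (z : (w.adicCompletion K) ⊗[K] V) : ∃ a : 𝓞 K, a ≠ 0 ∧ emb w a • z ∈ latCompletion w N := by
  have hadd : ∀ x y : (w.adicCompletion K) ⊗[K] V,
      (∃ a : 𝓞 K, a ≠ 0 ∧ emb w a • x ∈ latCompletion w N) →
      (∃ a : 𝓞 K, a ≠ 0 ∧ emb w a • y ∈ latCompletion w N) →
      (∃ a : 𝓞 K, a ≠ 0 ∧ emb w a • (x + y) ∈ latCompletion w N) := by
    rintro x y ⟨a, ha, ha'⟩ ⟨b, hb, hb'⟩
    refine ⟨a * b, mul_ne_zero ha hb, ?_⟩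
    rw [smul_add]
    refine Submodule.add_mem _ ?_ ?_
    · rw [mul_comm, map_mul, mul_smul]; exact emb_smul_mem w _ b ha'
    · rw [map_mul, mul_smul]; exact emb_smul_mem w _ a hb'
  induction z using TensorProduct.induction_on with
  | zero => exact ⟨1, one_ne_zero, by simp⟩
  | add x y hx hy => exact hadd x y hx hy
  | tmul k x =>
    have hx : x ∈ Submodule.span K (N : Set V) := by rw [hN.2]; trivial
    induction hx using Submodule.span_induction generalizing k with
    | mem x hx =>
      obtain ⟨a, ha, ha'⟩ := adicCompletion.mul_nonZeroDivisor_mem_adicCompletionIntegers w k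
      refine ⟨a, nonZeroDivisors.ne_zero ha, ?_⟩
      have e : emb w a • (k ⊗ₜ[K] x) = (k * emb w a) • ((1 : w.adicCompletion K) ⊗ₜ[K] x) := by
        rw [TensorProduct.smul_tmul', TensorProduct.smul_tmul', smul_eq_mul, smul_eq_mul, mul_one,
          mul_comm]
      rw [e]
      exact smul_mem' w _ ha' (one_tmul_mem w hx)
    | zero => exact ⟨1, one_ne_zero, by simp⟩
    | add x y _ _ hx hy =>
      rw [TensorProduct.tmul_add]
      exact hadd _ _ (hx k) (hy k)
    | smul q x _ hx =>
      rw [← TensorProduct.smul_tmul]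
      exact hx _

lemma bound1 {N : Submodule (𝓞 K) V} (hN : IsZLat N) (w : HeightOneSpectrum (𝓞 K))
    (g : ((w.adicCompletion K) ⊗[K] V) →ₗ[w.adicCompletion K] ((w.adicCompletion K) ⊗[K] V)) :
    ∃ a : 𝓞 K, a ≠ 0 ∧ ∀ z ∈ latCompletion w N, emb w a • g z ∈ latCompletion w N := by
  obtain ⟨s, hs⟩ := hN.1
  obtain ⟨a, ha, ha'⟩ := fin_prod s
    (fun x a => emb w a • g ((1 : w.adicCompletion K) ⊗ₜ[K] x) ∈ latCompletion w N)
    (fun x a b h => by rw [map_mul, mul_smul]; exact emb_smul_mem w _ b h)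
    (fun x _ => bound0 hN w _)
  refine ⟨a, ha, latCompletion_smul w g _ ?_⟩
  intro x hx
  rw [← hs] at hx
  induction hx using Submodule.span_induction with
  | mem x hx => exact ha' x hx
  | zero => simp
  | add x y _ _ hx hy =>
    rw [TensorProduct.tmul_add, map_add, smul_add]; exact Submodule.add_mem _ hx hy
  | smul r x _ hx =>
    rw [one_tmul_smul, map_smul, smul_comm]
    exact emb_smul_mem w _ r hx

lemma bound2 {N M : Submodule (𝓞 K) V} (hN : IsZLat N) (hM : IsZLat M) :
    ∃ a : 𝓞 K, a ≠ 0 ∧ ∀ x ∈ M, a • x ∈ N := by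
  have key : ∀ x : V, ∃ a : 𝓞 K, a ≠ 0 ∧ a • x ∈ N := by
    intro x
    have hx : x ∈ Submodule.span K (N : Set V) := by rw [hN.2]; trivial
    induction hx using Submodule.span_induction with
    | mem x hx => exact ⟨1, one_ne_zero, by simpa using hx⟩
    | zero => exact ⟨1, one_ne_zero, by simp⟩
    | add x y _ _ hx hy =>
      obtain ⟨a, ha, ha'⟩ := hx
      obtain ⟨b, hb, hb'⟩ := hy
      refine ⟨a * b, mul_ne_zero ha hb, ?_⟩
      rw [smul_add]
      refine Submodule.add_mem _ ?_ ?_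
      · rw [mul_comm, mul_smul]; exact N.smul_mem b ha'
      · rw [mul_smul]; exact N.smul_mem a hb'
    | smul q x _ hx =>
      obtain ⟨a, ha, ha'⟩ := hx
      obtain ⟨⟨p, d⟩, hpd⟩ := IsLocalization.surj ((𝓞 K)⁰) q
      refine ⟨a * d, mul_ne_zero ha (nonZeroDivisors.ne_zero d.2), ?_⟩
      have e : (a * d) • q • x = p • a • x := by
        simp only [← algebraMap_smul K (_ : 𝓞 K) (_ : V), smul_smul]
        congr 1
        simp only at hpd
        rw [map_mul, ← hpd]; ring
      rw [e]
      exact N.smul_mem p ha'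
  obtain ⟨s, hs⟩ := hM.1
  obtain ⟨a, ha, ha'⟩ := fin_prod s (fun x a => a • x ∈ N)
    (fun x a b h => by rw [mul_smul]; exact N.smul_mem b h)
    (fun x _ => key x)
  refine ⟨a, ha, ?_⟩
  intro x hx
  rw [← hs] at hx
  induction hx using Submodule.span_induction with
  | mem x hx => exact ha' x hx
  | zero => simp
  | add x y _ _ hx hy =>
    rw [smul_add]; exact Submodule.add_mem _ hx hy
  | smul r x _ hx =>
    rw [smul_comm]
    exact N.smul_mem r hx

lemma le_of_unit {N M : Submodule (𝓞 K) V} {a : 𝓞 K} (h : ∀ x ∈ M, a • x ∈ N)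
    (w : HeightOneSpectrum (𝓞 K)) (hw : w.intValuation a = 1) :
    latCompletion w M ≤ latCompletion w N := by
  have ha : a ≠ 0 := by rintro rfl; simp at hw
  refine latCompletion_le w fun x hx => ?_
  have e : (1 : w.adicCompletion K) ⊗ₜ[K] x =
      (emb w a)⁻¹ • ((1 : w.adicCompletion K) ⊗ₜ[K] (a • x)) := by
    rw [one_tmul_smul, inv_smul_smul₀ (emb_ne_zero w ha)]
  rw [e]
  exact smul_mem' w _ (by rw [map_inv₀, emb_val, hw, inv_one]) (one_tmul_mem w (h x hx))

lemma finite_ne {N M : Submodule (𝓞 K) V} (hN : IsZLat N) (hM : IsZLat M) :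
    {w : HeightOneSpectrum (𝓞 K) | latCompletion w N ≠ latCompletion w M}.Finite := by
  obtain ⟨a, ha, ha'⟩ := bound2 hN hM
  obtain ⟨b, hb, hb'⟩ := bound2 hM hN
  have hfin : ∀ c : 𝓞 K, c ≠ 0 →
      {w : HeightOneSpectrum (𝓞 K) | w.asIdeal ∣ Ideal.span {c}}.Finite := fun c hc =>
    Ideal.finite_factors (by simpa using hc)
  refine ((hfin a ha).union (hfin b hb)).subset ?_
  intro w hw
  by_contra hcon
  simp only [Set.mem_union, Set.mem_ofPred_eq, not_or] at hcon
  have hu : ∀ c : 𝓞 K, ¬ w.asIdeal ∣ Ideal.span {c} → w.intValuation c = 1 := by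
    intro c hc
    rw [← intValuation_lt_one_iff_dvd] at hc
    exact le_antisymm (w.intValuation_le_one c) (not_lt.1 hc)
  exact hw (le_antisymm (le_of_unit hb' w (hu b hcon.2)) (le_of_unit ha' w (hu a hcon.1)))

/-- Image of a local lattice under a linear automorphism. -/
def mapW (w : HeightOneSpectrum (𝓞 K))
    (g : ((w.adicCompletion K) ⊗[K] V) ≃ₗ[w.adicCompletion K] ((w.adicCompletion K) ⊗[K] V))
    (P : Submodule ((w.adicCompletionIntegers K).toSubring) ((w.adicCompletion K) ⊗[K] V)) :
    Submodule ((w.adicCompletionIntegers K).toSubring) ((w.adicCompletion K) ⊗[K] V) where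
  carrier := g '' P
  add_mem' := by
    rintro _ _ ⟨x, hx, rfl⟩ ⟨y, hy, rfl⟩
    exact ⟨x + y, P.add_mem hx hy, map_add g x y⟩
  zero_mem' := ⟨0, P.zero_mem, map_zero g⟩
  smul_mem' := by
    rintro r _ ⟨x, hx, rfl⟩
    exact ⟨r • x, P.smul_mem r hx, map_smul g r.1 x⟩

lemma exists_transport [FiniteDimensional K V] {N : Submodule (𝓞 K) V} (hN : IsZLat N)
    (g : ∀ w : HeightOneSpectrum (𝓞 K), 
      ((w.adicCompletion K) ⊗[K] V) ≃ₗ[w.adicCompletion K] ((w.adicCompletion K) ⊗[K] V))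
    (S : Set (HeightOneSpectrum (𝓞 K))) (hS : S.Finite)
    (hg : ∀ w, w ∉ S → g w = LinearEquiv.refl _ _) :
    ∃ N' : Submodule (𝓞 K) V, IsZLat N' ∧ 
      ∀ w, ⇑(g w) '' (latCompletion w N : Set _) = (latCompletion w N' : Set _) := by
  obtain ⟨c, hc, hc'⟩ := fin_prod hS.toFinset
    (fun w a => (∀ z ∈ latCompletion w N, emb w a • g w z ∈ latCompletion w N) ∧
      (∀ z ∈ latCompletion w N, emb w a • (g w).symm z ∈ latCompletion w N))
    (fun w a b h => by
      refine ⟨fun z hz => ?_, fun z hz => ?_⟩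
      · rw [map_mul, mul_smul]; exact emb_smul_mem w _ b (h.1 z hz)
      · rw [map_mul, mul_smul]; exact emb_smul_mem w _ b (h.2 z hz))
    (fun w _ => by
      obtain ⟨a, ha, ha'⟩ := bound1 hN w (g w).toLinearMap
      obtain ⟨b, hb, hb'⟩ := bound1 hN w (g w).symm.toLinearMap
      refine ⟨a * b, mul_ne_zero ha hb, fun z hz => ?_, fun z hz => ?_⟩
      · rw [mul_comm, map_mul, mul_smul]; exact emb_smul_mem w _ b (ha' z hz)
      · rw [map_mul, mul_smul]; exact emb_smul_mem w _ a (hb' z hz))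
  have hc2 : ∀ w, (∀ z ∈ latCompletion w N, emb w c • g w z ∈ latCompletion w N) ∧
      (∀ z ∈ latCompletion w N, emb w c • (g w).symm z ∈ latCompletion w N) := by
    intro w
    by_cases hw : w ∈ S
    · exact hc' w (hS.mem_toFinset.2 hw)
    · rw [hg w hw]
      exact ⟨fun z hz => emb_smul_mem w _ c hz, fun z hz => emb_smul_mem w _ c hz⟩
  obtain ⟨N', h1, h2⟩ := glue N hN c hc (fun w => mapW w (g w) (latCompletion w N))
    (fun w x hx => ⟨_, (hc2 w).2 x hx, by simp⟩)
    (fun w x hx => by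
      obtain ⟨y, hy, rfl⟩ := hx
      exact (hc2 w).1 y hy)
  refine ⟨N', h1, fun w => ?_⟩
  rw [h2 w]; rfl

lemma IsZLat.map {N : Submodule (𝓞 K) V} (hN : IsZLat N) (h : V ≃ₗ[K] V) :
    IsZLat (N.map (h.toLinearMap.restrictScalars (𝓞 K))) := by
  refine ⟨hN.1.map _, ?_⟩
  have : ((N.map (h.toLinearMap.restrictScalars (𝓞 K)) : Submodule (𝓞 K) V) : Set V) =
      h.toLinearMap '' (N : Set V) := rfl
  rw [this, Submodule.span_image, hN.2, Submodule.map_top, LinearEquiv.range]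

lemma latCompletion_map (w : HeightOneSpectrum (𝓞 K)) (N : Submodule (𝓞 K) V) (h : V ≃ₗ[K] V) :
    ⇑(h.baseChange K (w.adicCompletion K) V V) '' (latCompletion w N : Set _) =
      (latCompletion w (N.map (h.toLinearMap.restrictScalars (𝓞 K))) : Set _) := by
  set g := h.baseChange K (w.adicCompletion K) V V with hgdef
  have hg : ∀ x : V, g (1 ⊗ₜ x) = 1 ⊗ₜ (h x) := fun x => rfl
  apply Set.Subset.antisymm
  · rintro _ ⟨x, hx, rfl⟩
    have := latCompletion_smul w (N := N) g.toLinearMap 1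
      (P := latCompletion w (N.map (h.toLinearMap.restrictScalars (𝓞 K)))) (fun x hx => by
        rw [one_smul]
        exact one_tmul_mem w ⟨x, hx, rfl⟩) x hx
    rwa [one_smul] at this
  · have : latCompletion w (N.map (h.toLinearMap.restrictScalars (𝓞 K))) ≤
        mapW w g (latCompletion w N) := by
      refine latCompletion_le w ?_
      rintro _ ⟨x, hx, rfl⟩
      exact ⟨1 ⊗ₜ x, one_tmul_mem w hx, rfl⟩
    exact this

lemma baseChange_isometry (Φ : LinearMap.BilinForm K V) (w : HeightOneSpectrum (𝓞 K))
    (h : V ≃ₗ[K] V) (hh : ∀ x y, Φ (h x) (h y) = Φ x y) (x y : (w.adicCompletion K) ⊗[K] V) :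
    Φ.baseChange (w.adicCompletion K) (h.baseChange K (w.adicCompletion K) V V x)
      (h.baseChange K (w.adicCompletion K) V V y) = Φ.baseChange (w.adicCompletion K) x y := by
  have hg : ∀ (k : w.adicCompletion K) (x : V),
      h.baseChange K (w.adicCompletion K) V V (k ⊗ₜ x) = k ⊗ₜ (h x) := fun k x => rfl
  induction x using TensorProduct.induction_on with
  | zero => simp
  | add x x' hx hx' => simp only [map_add, LinearMap.add_apply, hx, hx']
  | tmul k x =>
    induction y using TensorProduct.induction_on with
    | zero => simp
    | add y y' hy hy' => simp only [map_add, hy, hy']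
    | tmul l y =>
      rw [hg, hg, LinearMap.BilinForm.baseChange_tmul, LinearMap.BilinForm.baseChange_tmul, hh]

end Helpers

theorem classNumber_one_iff_aut_transitive
    [FiniteDimensional K V]
    (Φ : LinearMap.BilinForm K V)
    (hsymm : ∀ x y : V, Φ x y = Φ y x)
    (hnd : ∀ x : V, (∀ y : V, Φ x y = 0) → x = 0)
    (r : ℕ) (L : Fin (r + 1) → Submodule (𝓞 K) V)
    (hlat : ∀ i, IsZLat (L i)) :
    (∀ L' ∈ genusSet Φ L, IsIsom Φ L L') ↔
      ((∀ M ∈ genusSet Φ (fun _ : Fin 1 => L 0),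
          IsIsom Φ (fun _ : Fin 1 => L 0) M) ∧
       (∀ L' L'', L' ∈ genusSet Φ L → L'' ∈ genusSet Φ L →
          L' 0 = L 0 → L'' 0 = L 0 →
          ∃ g : V ≃ₗ[K] V, (∀ x y, Φ (g x) (g y) = Φ x y) ∧
            ⇑g '' ((L 0 : Set V)) = ((L 0 : Set V)) ∧
            ∀ i, ⇑g '' ((L' i : Set V)) = ((L'' i : Set V)))) := by
  classical
  constructor
  · intro H
    refine ⟨?_, ?_⟩
    · intro M hM
      choose g hgi hg using hM.2
      have hM0 : IsZLat (M 0) := hM.1 0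
      let S : Set (HeightOneSpectrum (𝓞 K)) :=
        {w | latCompletion w (L 0) ≠ latCompletion w (M 0)}
      let g' : ∀ w : HeightOneSpectrum (𝓞 K), 
        ((w.adicCompletion K) ⊗[K] V) ≃ₗ[w.adicCompletion K] ((w.adicCompletion K) ⊗[K] V) :=
        fun w => if w ∈ S then g w else LinearEquiv.refl _ _
      have hpos : ∀ w, w ∈ S → g' w = g w := fun w hw => if_pos hw
      have hneg : ∀ w, w ∉ S → g' w = LinearEquiv.refl _ _ := fun w hw => if_neg hw
      choose N hN hN' using fun i => exists_transport (hlat i) g' S (finite_ne (hlat 0) hM0) hneg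
      obtain ⟨f, hf, hf'⟩ := H (fun i => if i = 0 then M 0 else N i) ⟨by
          intro i
          by_cases hi : i = 0
          · simpa only [hi, if_true] using hM0
          · simpa only [hi, if_false] using hN i, by
          intro w
          refine ⟨g' w, ?_, ?_⟩
          · by_cases hw : w ∈ S
            · rw [hpos w hw]; exact hgi w
            · rw [hneg w hw]; intro x y; rfl
          · intro i
            by_cases hi : i = 0
            · subst hi
              simp only [if_true]
              by_cases hw : w ∈ S
              · rw [hpos w hw]; exact hg w 0
              · rw [hneg w hw]
                have : latCompletion w (L 0) = latCompletion w (M 0) := not_not.1 hw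
                rw [this]
                exact Set.image_id _
            · simp only [hi, if_false]
              exact hN' i w⟩
      refine ⟨f, hf, fun i => ?_⟩
      have hi : i = 0 := Subsingleton.elim _ _
      subst hi
      simpa only [if_true] using hf' 0
    · intro L' L'' h' h'' h0' h0''
      obtain ⟨f, hf, hf'⟩ := H L' h'
      obtain ⟨g, hg, hg'⟩ := H L'' h''
      have hi : ∀ i, ⇑(f.symm.trans g) '' (L' i : Set V) = (L'' i : Set V) := by
        intro i
        rw [← hf' i, ← hg' i, ← Set.image_comp]
        apply Set.image_congr
        intro x _
        simp
      refine ⟨f.symm.trans g, ?_, ?_, hi⟩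
      · intro x y
        rw [LinearEquiv.trans_apply, LinearEquiv.trans_apply, hg, ← hf, f.apply_symm_apply,
          f.apply_symm_apply]
      · have := hi 0
        rwa [h0', h0''] at this
  · rintro ⟨H1, H2⟩ L' hL'
    obtain ⟨h, hh, hh'⟩ := H1 (fun _ => L' 0) ⟨fun _ => hL'.1 0, fun w => by
      obtain ⟨g, hg, hg'⟩ := hL'.2 w
      exact ⟨g, hg, fun _ => hg' 0⟩⟩
    have hs : ∀ x y, Φ (h.symm x) (h.symm y) = Φ x y := by
      intro x y
      rw [← hh, h.apply_symm_apply, h.apply_symm_apply]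
    have hLL : L ∈ genusSet Φ L := ⟨hlat, fun w => ⟨LinearEquiv.refl _ _, fun _ _ => rfl,
      fun i => Set.image_id _⟩⟩
    obtain ⟨f, hf, -, hf'⟩ := H2 L
      (fun i => (L' i).map (h.symm.toLinearMap.restrictScalars (𝓞 K))) hLL
      ⟨fun i => (hL'.1 i).map h.symm, fun w => by
        obtain ⟨g, hg, hg'⟩ := hL'.2 w
        refine ⟨g.trans (h.symm.baseChange K (w.adicCompletion K) V V), ?_, ?_⟩
        · intro x y
          rw [LinearEquiv.trans_apply, LinearEquiv.trans_apply, baseChange_isometry Φ w _ hs, hg]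
        · intro i
          rw [← latCompletion_map, ← hg' i, ← Set.image_comp]
          rfl⟩ rfl (by
        apply SetLike.coe_injective
        change h.symm '' (L' 0 : Set V) = _
        rw [← hh' 0, ← Set.image_comp]
        simp)
    refine ⟨f.trans h, fun x y => by rw [LinearEquiv.trans_apply, LinearEquiv.trans_apply, hh, hf],
      fun i => ?_⟩
    have e : ⇑(f.trans h) '' (L i : Set V) = h '' (f '' (L i : Set V)) := by
      rw [← Set.image_comp]; rfl
    rw [e, hf' i]
    change h '' (h.symm '' (L' i : Set V)) = _
    rw [← Set.image_comp]
    simp
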